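/- arXiv:1003.5882 — 8 statements merged into one kernel-verified Lean document; each statement's English description precedes it below -/
import Mathlib

section
/- (q-Leibniz formula, Prop. 2.2(3), first form) Let a, b ∈ A, q_ab, q_bb ∈ k, and define iterated q-commutators by c_0 := a and c_{k+1} := c_k * b − (q_ab * q_bb^k) • (b * c_k). Then for every integer r ≥ 1: a * b^r − q_ab^r • (b^r * a) = Σ_{i=0}^{r−1} q_ab^i • binom(r,i)_{q_bb} • (b^i * c_{r−i}). -/
/-- Gaussian binomial coefficient `binom(n,i)_q`, defined by `binom(n,0)_q = 1`,
`binom(0,i)_q = 0` for `i ≥ 1`, and the q-Pascal rule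
`binom(n+1,i)_q = q^i * binom(n,i)_q + binom(n,i-1)_q`. -/
def qBinom {k : Type*} [Field k] (q : k) : ℕ → ℕ → k
  | _, 0 => 1
  | 0, _ + 1 => 0
  | n + 1, i + 1 => q ^ (i + 1) * qBinom q n (i + 1) + qBinom q n i

theorem qBinom_zero_right {k : Type*} [Field k] (q : k) (n : ℕ) : qBinom q n 0 = 1 := by
  cases n <;> simp [qBinom]

theorem qBinom_of_lt {k : Type*} [Field k] (q : k) (n : ℕ) :
    ∀ i, n < i → qBinom q n i = 0 := by
  induction n with
  | zero =>
    intro i hi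
    obtain ⟨j, rfl⟩ : ∃ j, i = j + 1 := ⟨i - 1, by omega⟩
    simp [qBinom]
  | succ n ih =>
    intro i hi
    obtain ⟨j, rfl⟩ : ∃ j, i = j + 1 := ⟨i - 1, by omega⟩
    simp [qBinom, ih (j + 1) (by omega), ih j (by omega)]

theorem qBinom_self {k : Type*} [Field k] (q : k) (n : ℕ) : qBinom q n n = 1 := by
  induction n with
  | zero => simp [qBinom]
  | succ n ih => simp [qBinom, ih, qBinom_of_lt q n (n + 1) (by omega)]

theorem qLeibniz_aux {k A : Type*} [Field k] [Ring A] [Algebra k A]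
    (b : A) (qab qbb : k) (c : ℕ → A)
    (hc : ∀ n : ℕ, c (n + 1) = c n * b - (qab * qbb ^ n) • (b * c n)) (r : ℕ) :
    ∀ m : ℕ, c m * b ^ r = ∑ i ∈ Finset.range (r + 1),
      (qab ^ i * qbb ^ (m * i) * qBinom qbb r i) • (b ^ i * c (m + r - i)) := by
  induction r with
  | zero => intro m; simp [qBinom]
  | succ r ih =>
    intro m
    have h1 : c m * b ^ (r + 1) = c (m + 1) * b ^ r + (qab * qbb ^ m) • (b * (c m * b ^ r)) := by
      rw [hc m, pow_succ', sub_mul, smul_mul_assoc]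
      simp only [mul_assoc, sub_add_cancel]
    have h2 : c (m + 1) * b ^ r = ∑ i ∈ Finset.range (r + 1 + 1),
        (qab ^ i * qbb ^ ((m + 1) * i) * qBinom qbb r i) • (b ^ i * c (m + 1 + r - i)) := by
      rw [Finset.sum_range_succ, ← ih (m + 1), qBinom_of_lt qbb r (r + 1) (by omega)]
      simp
    rw [h1, h2, ih m, Finset.sum_range_succ', Finset.sum_range_succ' _ (r + 1), Finset.mul_sum,
      Finset.smul_sum, add_right_comm, ← Finset.sum_add_distrib]
    congr 1
    · refine Finset.sum_congr rfl fun i _ => ?_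
      have e1 : m + 1 + r - (i + 1) = m + r - i := by omega
      have e2 : m + (r + 1) - (i + 1) = m + r - i := by omega
      rw [e1, e2, mul_smul_comm, ← mul_assoc, ← pow_succ', smul_smul, ← add_smul]
      congr 1
      simp only [qBinom]
      ring
    · have e : m + 1 + r = m + (r + 1) := by omega
      simp [qBinom_zero_right, e]

/-- q-Leibniz formula, first form: `[a, b^r]` expanded via iterated q-commutators. -/
theorem qLeibniz_first {k A : Type*} [Field k] [Ring A] [Algebra k A]
    (a b : A) (qab qbb : k) (c : ℕ → A)
    (hc0 : c 0 = a)
    (hc : ∀ n : ℕ, c (n + 1) = c n * b - (qab * qbb ^ n) • (b * c n))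
    (r : ℕ) (hr : 1 ≤ r) :
    a * b ^ r - (qab ^ r) • (b ^ r * a)
      = ∑ i ∈ Finset.range r, (qab ^ i * qBinom qbb r i) • (b ^ i * c (r - i)) := by
  have h := qLeibniz_aux b qab qbb c hc r 0
  rw [Finset.sum_range_succ, hc0] at h
  rw [h, qBinom_self]
  simp [hc0]
end

section
/- (restricted q-Leibniz formula, Prop. 2.2(4), first form) Assume char k = 0. Let a, b ∈ A, q_ab, q_bb ∈ k, and define c_0 := a and c_{k+1} := c_k * b − (q_ab * q_bb^k) • (b * c_k). If q_bb has multiplicative order exactly r (i.e. q_bb^r = 1 and q_bb^m ≠ 1 for all 1 ≤ m < r), then a * b^r − q_ab^r • (b^r * a) = c_r. -/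
/-- Gaussian binomial coefficients. -/
def gaussB {k : Type*} [Field k] (q : k) : ℕ → ℕ → k
  | _, 0 => 1
  | 0, _ + 1 => 0
  | n + 1, i + 1 => gaussB q n i + q ^ (i + 1) * gaussB q n (i + 1)

theorem gaussB_zero {k : Type*} [Field k] (q : k) (n : ℕ) : gaussB q n 0 = 1 := by
  cases n <;> simp [gaussB]

theorem gaussB_succ {k : Type*} [Field k] (q : k) (n i : ℕ) :
    gaussB q (n + 1) (i + 1) = gaussB q n i + q ^ (i + 1) * gaussB q n (i + 1) := by
  simp [gaussB]

theorem gaussB_gt {k : Type*} [Field k] (q : k) (n : ℕ) :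
    ∀ i, n < i → gaussB q n i = 0 := by
  induction n with
  | zero => intro i hi; cases i with
    | zero => omega
    | succ i => simp [gaussB]
  | succ n ih => intro i hi; cases i with
    | zero => omega
    | succ i => rw [gaussB_succ, ih i (by omega), ih (i + 1) (by omega)]; simp

theorem gaussB_self {k : Type*} [Field k] (q : k) (n : ℕ) : gaussB q n n = 1 := by
  induction n with
  | zero => simp [gaussB]
  | succ n ih => rw [gaussB_succ, ih, gaussB_gt q n (n + 1) (by omega)]; simp

theorem gaussB_absorb {k : Type*} [Field k] (q : k) (n : ℕ) :
    ∀ i, (q ^ (i + 1) - 1) * gaussB q (n + 1) (i + 1) = (q ^ (n + 1) - 1) * gaussB q n i := by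
  induction n with
  | zero => intro i; cases i <;> simp [gaussB]
  | succ m ih =>
    intro i
    have h1 := ih i
    rw [gaussB_succ q (m + 1) i]
    cases i with
    | zero =>
      simp only [gaussB_zero] at *
      linear_combination q ^ (0 + 1) * h1
    | succ j =>
      have h2 := ih j
      have h3 := gaussB_succ q m j
      linear_combination q ^ (j + 2) * h1 - q * (q ^ (m + 1) - 1) * h3 + q * h2

theorem qLeibniz_expand {k A : Type*} [Field k] [Ring A] [Algebra k A]
    (a b : A) (qab qbb : k) (c : ℕ → A) (hc0 : c 0 = a)
    (hc : ∀ n : ℕ, c (n + 1) = c n * b - (qab * qbb ^ n) • (b * c n)) (n : ℕ) :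
    a * b ^ n = ∑ i ∈ Finset.range (n + 1),
      (gaussB qbb n i * qab ^ (n - i)) • (b ^ (n - i) * c i) := by
  induction n with
  | zero => simp [gaussB, hc0]
  | succ n ih =>
    have hcb : ∀ i, c i * b = c (i + 1) + (qab * qbb ^ i) • (b * c i) := by
      intro i; rw [hc]; abel
    have key : a * b ^ (n + 1) = ∑ i ∈ Finset.range (n + 1),
        (gaussB qbb n i * qab ^ (n - i)) • (b ^ (n - i) * c (i + 1)) +
        ∑ i ∈ Finset.range (n + 1),
          (qbb ^ i * gaussB qbb n i * qab ^ (n + 1 - i)) • (b ^ (n + 1 - i) * c i) := by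
      rw [pow_succ, ← mul_assoc, ih, Finset.sum_mul, ← Finset.sum_add_distrib]
      refine Finset.sum_congr rfl fun i hi => ?_
      have hi' : n + 1 - i = (n - i) + 1 := by
        have := Finset.mem_range.mp hi
        omega
      rw [smul_mul_assoc, mul_assoc, hcb, mul_add, smul_add, mul_smul_comm, smul_smul, hi',
        pow_succ b]
      congr 2
      · ring
      · rw [mul_assoc]
    have ext : ∑ i ∈ Finset.range (n + 1),
          (qbb ^ i * gaussB qbb n i * qab ^ (n + 1 - i)) • (b ^ (n + 1 - i) * c i) =
        ∑ i ∈ Finset.range (n + 1 + 1),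
          (qbb ^ i * gaussB qbb n i * qab ^ (n + 1 - i)) • (b ^ (n + 1 - i) * c i) := by
      rw [Finset.sum_range_succ _ (n + 1), gaussB_gt qbb n (n + 1) (by omega)]
      simp
    rw [key, ext, Finset.sum_range_succ' _ (n + 1), Finset.sum_range_succ' _ (n + 1),
      ← add_assoc, ← Finset.sum_add_distrib]
    congr 1
    · refine Finset.sum_congr rfl fun i hi => ?_
      rw [gaussB_succ, Nat.add_sub_add_right, ← add_smul]
      congr 1
      ring
    · simp [gaussB_zero]

/-- Restricted q-Leibniz formula, first form: if `q_bb` has multiplicative order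
exactly `r`, then `[a, b^r] = [..[[a,b],b]..,b]` (`r`-fold iterated q-commutator). -/
theorem restricted_qLeibniz_first {k A : Type*} [Field k] [CharZero k]
    [Ring A] [Algebra k A]
    (a b : A) (qab qbb : k) (c : ℕ → A)
    (hc0 : c 0 = a)
    (hc : ∀ n : ℕ, c (n + 1) = c n * b - (qab * qbb ^ n) • (b * c n))
    (r : ℕ) (hr : 1 ≤ r)
    (hord : qbb ^ r = 1) (hmin : ∀ m : ℕ, 1 ≤ m → m < r → qbb ^ m ≠ 1) :
    a * b ^ r - (qab ^ r) • (b ^ r * a) = c r := by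
  obtain ⟨n, rfl⟩ : ∃ n, r = n + 1 := ⟨r - 1, by omega⟩
  rw [qLeibniz_expand a b qab qbb c hc0 hc, Finset.sum_range_succ, Finset.sum_range_succ',
    Finset.sum_eq_zero]
  · simp [gaussB_zero, gaussB_self, hc0]
  · intro i hi
    have hi' := Finset.mem_range.mp hi
    have h := gaussB_absorb qbb n i
    rw [hord, sub_self, zero_mul] at h
    rcases mul_eq_zero.mp h with h | h
    · exact absurd (sub_eq_zero.mp h) (hmin (i + 1) (by omega) (by omega))
    · rw [h]; simp
end

section
/- (Lemma 4.1(1)) Let g ∈ A satisfy Δ(g) = g ⊗ g and ε(g) = 1, let x ∈ A satisfy Δ(x) = x ⊗ 1 + g ⊗ x, and suppose g*x = q • (x*g) where q ∈ k has finite multiplicative order N. Then x^N is (1, g^N)-skew-primitive: Δ(x^N) = x^N ⊗ 1 + g^N ⊗ x^N. -/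
open TensorProduct

/-- Gaussian binomial coefficients. -/
def qBin {k : Type*} [Field k] (q : k) : ℕ → ℕ → k
  | _, 0 => 1
  | 0, _ + 1 => 0
  | n + 1, i + 1 => qBin q n i + q ^ (i + 1) * qBin q n (i + 1)

theorem qBin_zero {k : Type*} [Field k] (q : k) (n : ℕ) : qBin q n 0 = 1 := by
  cases n <;> simp [qBin]

theorem qBin_of_lt {k : Type*} [Field k] (q : k) (n : ℕ) : ∀ i, n < i → qBin q n i = 0 := by
  induction n with
  | zero => intro i hi; obtain ⟨j, rfl⟩ := Nat.exists_eq_succ_of_ne_zero hi.ne'; simp [qBin]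
  | succ n ih =>
    intro i hi
    obtain ⟨j, rfl⟩ := Nat.exists_eq_succ_of_ne_zero (show i ≠ 0 by omega)
    simp [qBin, ih j (by omega), ih (j + 1) (by omega)]

theorem qBin_self {k : Type*} [Field k] (q : k) (n : ℕ) : qBin q n n = 1 := by
  induction n with
  | zero => simp [qBin]
  | succ n ih => simp [qBin, ih, qBin_of_lt q n (n + 1) (by omega)]

theorem qBin_absorb {k : Type*} [Field k] (q : k) (n : ℕ) :
    ∀ i, (1 - q ^ (i + 1)) * qBin q (n + 1) (i + 1) = (1 - q ^ (n + 1)) * qBin q n i := by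
  induction n with
  | zero => intro i; cases i <;> simp [qBin]
  | succ m ih =>
    intro i
    have h1 := ih i
    have e : qBin q (m + 1 + 1) (i + 1)
      = qBin q (m + 1) i + q ^ (i + 1) * qBin q (m + 1) (i + 1) := by rw [qBin]
    rw [e]
    cases i with
    | zero =>
      simp only [qBin_zero] at h1 ⊢
      linear_combination q * h1
    | succ j =>
      have h2 := ih j
      have e2 : qBin q (m + 1) (j + 1)
        = qBin q m j + q ^ (j + 1) * qBin q m (j + 1) := by rw [qBin]
      linear_combination q ^ (j + 2) * h1 - q * (1 - q ^ (m + 1)) * e2 + q * h2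

theorem q_binomial {k B : Type*} [Field k] [Ring B] [Algebra k B] (q : k) (a b : B)
    (h : b * a = q • (a * b)) (n : ℕ) :
    (a + b) ^ n = ∑ i ∈ Finset.range (n + 1), qBin q n i • (a ^ i * b ^ (n - i)) := by
  have hc : ∀ i, b * a ^ i = q ^ i • (a ^ i * b) := by
    intro i
    induction i with
    | zero => simp
    | succ i ih =>
      rw [pow_succ, ← mul_assoc, ih, smul_mul_assoc, mul_assoc, h, mul_smul_comm, smul_smul,
        pow_succ, mul_assoc]
  induction n with
  | zero => simp [qBin]
  | succ n ih =>
    have hb : b * (a + b) ^ n = ∑ i ∈ Finset.range (n + 1 + 1),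
        (q ^ i * qBin q n i) • (a ^ i * b ^ (n + 1 - i)) := by
      rw [Finset.sum_range_succ, qBin_of_lt q n (n + 1) (by omega), mul_zero, zero_smul, add_zero,
        ih, Finset.mul_sum]
      refine Finset.sum_congr rfl fun i hi => ?_
      have hi' : n + 1 - i = (n - i) + 1 := by have := Finset.mem_range.mp hi; omega
      rw [mul_smul_comm, ← mul_assoc, hc, smul_mul_assoc, smul_smul, hi', pow_succ' b, mul_assoc,
        mul_comm (q ^ i)]
    rw [pow_succ', add_mul, hb, Finset.sum_range_succ', ih, Finset.mul_sum, ← add_assoc,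
      ← Finset.sum_add_distrib, Finset.sum_range_succ' _ (n + 1)]
    congr 1
    · refine Finset.sum_congr rfl fun i hi => ?_
      rw [qBin, Nat.add_sub_add_right, add_smul, mul_smul_comm, pow_succ' a, mul_assoc]
    · simp [qBin_zero]

/-- Lemma 4.1(1): if `g` is group-like, `x` is `(1,g)`-skew-primitive and
`g*x = q • (x*g)` with `ord q = N < ∞`, then `x^N` is `(1,g^N)`-skew-primitive. -/
theorem pow_ord_skew_primitive {k A : Type*} [Field k] [CharZero k]
    [Ring A] [Bialgebra k A]
    (g x : A) (q : k)
    (hg : Coalgebra.comul (R := k) g = g ⊗ₜ[k] g)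
    (hεg : Coalgebra.counit (R := k) g = 1)
    (hx : Coalgebra.comul (R := k) x = x ⊗ₜ[k] (1 : A) + g ⊗ₜ[k] x)
    (hgx : g * x = q • (x * g))
    (N : ℕ) (hN : 1 ≤ N)
    (hord : q ^ N = 1) (hmin : ∀ m : ℕ, 1 ≤ m → m < N → q ^ m ≠ 1) :
    Coalgebra.comul (R := k) (x ^ N) = (x ^ N) ⊗ₜ[k] (1 : A) + (g ^ N) ⊗ₜ[k] (x ^ N) := by
  obtain ⟨M, rfl⟩ : ∃ M, N = M + 1 := ⟨N - 1, by omega⟩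
  have hc : (g ⊗ₜ[k] x) * (x ⊗ₜ[k] (1 : A)) = q • ((x ⊗ₜ[k] (1 : A)) * (g ⊗ₜ[k] x)) := by
    simp only [Algebra.TensorProduct.tmul_mul_tmul, hgx, mul_one, one_mul,
      TensorProduct.smul_tmul']
  rw [Bialgebra.comul_pow, hx, q_binomial q _ _ hc, Finset.sum_range_succ,
    Finset.sum_range_succ', Finset.sum_eq_zero]
  · simp [qBin_zero, qBin_self, Algebra.TensorProduct.tmul_pow, add_comm]
  · intro i hi
    have hi' := Finset.mem_range.mp hi
    have h0 := qBin_absorb q M i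
    rw [hord, sub_self, zero_mul] at h0
    have h1 : (1 - q ^ (i + 1)) ≠ 0 :=
      sub_ne_zero.mpr (hmin (i + 1) (by omega) (by omega)).symm
    rw [(mul_eq_zero.mp h0).resolve_left h1, zero_smul]
end

section
/- (Lemma 4.1(2)) Suppose q11^{r−1} * q12 * q21 = 1 for some integer r ≥ 1 and q11^m ≠ 1 for all 1 ≤ m ≤ r−1 (i.e. r ≤ ord q11). Define u_0 := x2 and u_{k+1} := x1 * u_k − (q11^k * q12) • (u_k * x1). Then u_r is (1, g1^r * g2)-skew-primitive: Δ(u_r) = u_r ⊗ 1 + (g1^r * g2) ⊗ u_r. -/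
open TensorProduct

/-- Gaussian binomial `[a+i choose i]_q`, indexed by `a` and `i`. -/
def serreD {k : Type*} [Field k] (q : k) : ℕ → ℕ → k
  | 0, _ => 1
  | _ + 1, 0 => 1
  | a + 1, i + 1 => serreD q a (i + 1) + q ^ (a + 1) * serreD q (a + 1) i

theorem serreD_zero_left {k : Type*} [Field k] (q : k) (i : ℕ) : serreD q 0 i = 1 := by
  simp [serreD]

theorem serreD_zero_right {k : Type*} [Field k] (q : k) (a : ℕ) : serreD q a 0 = 1 := by
  cases a <;> simp [serreD]

theorem serreD_succ {k : Type*} [Field k] (q : k) (a i : ℕ) :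
    serreD q (a + 1) (i + 1) = serreD q a (i + 1) + q ^ (a + 1) * serreD q (a + 1) i := by
  simp [serreD]

theorem serreD_symm {k : Type*} [Field k] (q : k) (s : ℕ) : ∀ a i : ℕ, a + i = s →
    (1 - q ^ (i + 1)) * serreD q a (i + 1) = (1 - q ^ (a + 1)) * serreD q (a + 1) i := by
  induction s with
  | zero =>
    intro a i h
    obtain ⟨rfl, rfl⟩ : a = 0 ∧ i = 0 := by omega
    simp [serreD_zero_left, serreD_zero_right]
  | succ s ih =>
    intro a i h
    have L : (1 - q ^ (i + 1)) * serreD q a (i + 1) =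
        (1 - q ^ (a + i + 1)) * serreD q a i := by
      cases a with
      | zero => simp [serreD_zero_left]
      | succ a =>
        rw [serreD_succ, mul_add, ih a i (by omega)]
        ring
    have R : (1 - q ^ (a + 1)) * serreD q (a + 1) i =
        (1 - q ^ (a + i + 1)) * serreD q a i := by
      cases i with
      | zero => simp [serreD_zero_right]
      | succ j =>
        have := ih a j (by omega)
        rw [serreD_succ]
        linear_combination (-q ^ (a + 1)) * this
    rw [L, R]

/-- The coefficients in the comultiplication of the iterated commutators. -/
def serreC {k : Type*} [Field k] (q p : k) (a i : ℕ) : k :=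
  serreD q a i * ∏ j ∈ Finset.range a, (1 - q ^ (i + j) * p)

theorem serreC_succ {k : Type*} [Field k] (q p : k) (a i : ℕ) :
    serreC q p (a + 1) (i + 1) =
      (1 - q ^ (a + 2 * (i + 1)) * p) * serreC q p a (i + 1)
        + q ^ (a + 1) * serreC q p (a + 1) i := by
  unfold serreC
  have h := serreD_symm q _ a i rfl
  rw [Finset.prod_range_succ, Finset.prod_range_succ' (fun j => 1 - q ^ (i + j) * p)]
  have e : ∏ j ∈ Finset.range a, (1 - q ^ (i + (j + 1)) * p) =
      ∏ j ∈ Finset.range a, (1 - q ^ (i + 1 + j) * p) := by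
    refine Finset.prod_congr rfl fun j _ => ?_
    rw [show i + (j + 1) = i + 1 + j by ring]
  rw [e, serreD_succ]
  generalize ∏ j ∈ Finset.range a, (1 - q ^ (i + 1 + j) * p) = P
  simp only [add_zero]
  linear_combination (-(q ^ (a + i + 1) * p * P)) * h

theorem serreC_zero_left {k : Type*} [Field k] (q p : k) (i : ℕ) : serreC q p 0 i = 1 := by
  simp [serreC, serreD_zero_left]

theorem serreC_zero_right {k : Type*} [Field k] (q p : k) (a : ℕ) :
    serreC q p (a + 1) 0 = (1 - q ^ a * p) * serreC q p a 0 := by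
  simp [serreC, serreD_zero_right, Finset.prod_range_succ, mul_comm]

theorem serreC_sum {k M : Type*} [Field k] [AddCommGroup M] [Module k M] (q p : k)
    (T : ℕ → ℕ → M) (n : ℕ) :
    ∑ x ∈ Finset.HasAntidiagonal.antidiagonal (n + 1), serreC q p x.1 x.2 • T x.1 x.2 =
      ∑ x ∈ Finset.HasAntidiagonal.antidiagonal n, serreC q p x.1 x.2 •
        ((1 - q ^ (x.1 + 2 * x.2) * p) • T (x.1 + 1) x.2 + q ^ x.1 • T x.1 (x.2 + 1)) := by
  let α : ℕ → ℕ → k := fun a i =>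
    Nat.casesOn a 0 (fun b => (1 - q ^ (b + 2 * i) * p) * serreC q p b i)
  let β : ℕ → ℕ → k := fun a i => Nat.casesOn i 0 (fun j => q ^ a * serreC q p a j)
  have key : ∀ x ∈ Finset.HasAntidiagonal.antidiagonal (n + 1), serreC q p x.1 x.2 • T x.1 x.2 =
      α x.1 x.2 • T x.1 x.2 + β x.1 x.2 • T x.1 x.2 := by
    rintro ⟨a, i⟩ hx
    rw [Finset.HasAntidiagonal.mem_antidiagonal] at hx
    rw [← add_smul]
    congr 1
    rcases a with _ | a <;> rcases i with _ | i
    · simp at hx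
    · simp [α, β, serreC_zero_left]
    · simp [α, β, serreC_zero_right]
    · exact serreC_succ q p a i
  rw [Finset.sum_congr rfl key, Finset.sum_add_distrib,
    Finset.Nat.sum_antidiagonal_succ (f := fun x => α x.1 x.2 • T x.1 x.2),
    Finset.Nat.sum_antidiagonal_succ' (f := fun x => β x.1 x.2 • T x.1 x.2)]
  have a0 : ∀ i, α 0 i = 0 := fun _ => rfl
  have a1 : ∀ b i, α (b + 1) i = (1 - q ^ (b + 2 * i) * p) * serreC q p b i := fun _ _ => rfl
  have b0 : ∀ a, β a 0 = 0 := fun _ => rfl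
  have b1 : ∀ a j, β a (j + 1) = q ^ a * serreC q p a j := fun _ _ => rfl
  simp only [a0, a1, b0, b1, zero_smul, zero_add]
  rw [← Finset.sum_add_distrib]
  refine Finset.sum_congr rfl fun x _ => ?_
  module

/-- Lemma 4.1(2): if `q11^(r-1) * q12 * q21 = 1` and `r ≤ ord q11`, then the iterated
q-commutator `[x1^r x2]` is `(1, g1^r * g2)`-skew-primitive. -/
theorem serre_skew_primitive_left
    {k A : Type*} [Field k] [CharZero k] [Ring A] [Bialgebra k A]
    (g1 g2 x1 x2 : A) (q11 q12 q21 q22 : k)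
    (hg1 : Coalgebra.comul (R := k) g1 = g1 ⊗ₜ[k] g1)
    (hg2 : Coalgebra.comul (R := k) g2 = g2 ⊗ₜ[k] g2)
    (hεg1 : Coalgebra.counit (R := k) g1 = 1)
    (hεg2 : Coalgebra.counit (R := k) g2 = 1)
    (hcomm : g1 * g2 = g2 * g1)
    (hx1 : Coalgebra.comul (R := k) x1 = x1 ⊗ₜ[k] (1 : A) + g1 ⊗ₜ[k] x1)
    (hx2 : Coalgebra.comul (R := k) x2 = x2 ⊗ₜ[k] (1 : A) + g2 ⊗ₜ[k] x2)
    (hq11 : q11 ≠ 0) (hq12 : q12 ≠ 0) (hq21 : q21 ≠ 0) (hq22 : q22 ≠ 0)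
    (h11 : g1 * x1 = q11 • (x1 * g1)) (h12 : g1 * x2 = q12 • (x2 * g1))
    (h21 : g2 * x1 = q21 • (x1 * g2)) (h22 : g2 * x2 = q22 • (x2 * g2))
    (r : ℕ) (hr : 1 ≤ r)
    (hq : q11 ^ (r - 1) * q12 * q21 = 1)
    (hordr : ∀ m : ℕ, 1 ≤ m → m ≤ r - 1 → q11 ^ m ≠ 1)
    (u : ℕ → A) (hu0 : u 0 = x2)
    (hu : ∀ n : ℕ, u (n + 1) = x1 * u n - (q11 ^ n * q12) • (u n * x1)) :
    Coalgebra.comul (R := k) (u r) = (u r) ⊗ₜ[k] (1 : A) + (g1 ^ r * g2) ⊗ₜ[k] (u r) := by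
  have hgx : ∀ a : ℕ, g1 * x1 ^ a = q11 ^ a • (x1 ^ a * g1) := by
    intro a
    induction a with
    | zero => simp
    | succ a ih =>
      rw [pow_succ, ← mul_assoc, ih, smul_mul_assoc, mul_assoc, h11, mul_smul_comm, smul_smul,
        ← mul_assoc, ← pow_succ]
  have hxg : ∀ i : ℕ, g1 ^ i * x1 = q11 ^ i • (x1 * g1 ^ i) := by
    intro i
    induction i with
    | zero => simp
    | succ i ih =>
      rw [pow_succ', mul_assoc, ih, mul_smul_comm, ← mul_assoc, h11, smul_mul_assoc, smul_smul,
        mul_assoc, ← pow_succ]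
  have hgu : ∀ n : ℕ, g1 * u n = (q11 ^ n * q12) • (u n * g1) := by
    intro n
    induction n with
    | zero => simpa [hu0] using h12
    | succ n ih =>
      have e1 : g1 * (x1 * u n) = (q11 ^ (n + 1) * q12) • (x1 * u n * g1) := by
        rw [← mul_assoc, h11, smul_mul_assoc, mul_assoc, ih, mul_smul_comm, smul_smul, mul_assoc]
        congr 1; ring
      have e2 : g1 * (u n * x1) = (q11 ^ (n + 1) * q12) • (u n * x1 * g1) := by
        rw [← mul_assoc, ih, smul_mul_assoc, mul_assoc, h11, mul_smul_comm, smul_smul, mul_assoc (u n)]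
        congr 1; ring
      rw [hu, mul_sub, mul_smul_comm, e1, e2, sub_mul, smul_mul_assoc, smul_sub, smul_comm]
  let T : ℕ → ℕ → A ⊗[k] A := fun a i => (x1 ^ a * (g1 ^ i * g2)) ⊗ₜ[k] u i
  have main : ∀ n : ℕ, Coalgebra.comul (R := k) (u n) = u n ⊗ₜ[k] (1 : A) +
      ∑ x ∈ Finset.HasAntidiagonal.antidiagonal n, serreC q11 (q12 * q21) x.1 x.2 • T x.1 x.2 := by
    intro n
    induction n with
    | zero => simp [T, hu0, hx2, serreC_zero_left]
    | succ n ih =>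
      have hT : ∀ x ∈ Finset.HasAntidiagonal.antidiagonal n,
          (x1 ⊗ₜ[k] (1 : A) + g1 ⊗ₜ[k] x1) * T x.1 x.2 -
            (q11 ^ n * q12) • (T x.1 x.2 * (x1 ⊗ₜ[k] (1 : A) + g1 ⊗ₜ[k] x1)) =
          (1 - q11 ^ (x.1 + 2 * x.2) * (q12 * q21)) • T (x.1 + 1) x.2
            + q11 ^ x.1 • T x.1 (x.2 + 1) := by
        rintro ⟨a, i⟩ hx
        rw [Finset.HasAntidiagonal.mem_antidiagonal] at hx
        dsimp only at hx ⊢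
        subst hx
        have f1 : x1 * (x1 ^ a * (g1 ^ i * g2)) = x1 ^ (a + 1) * (g1 ^ i * g2) := by
          rw [← mul_assoc, ← pow_succ']
        have f2 : g1 * (x1 ^ a * (g1 ^ i * g2)) = q11 ^ a • (x1 ^ a * (g1 ^ (i + 1) * g2)) := by
          rw [← mul_assoc, hgx, smul_mul_assoc, pow_succ']
          simp only [mul_assoc]
        have f3 : x1 ^ a * (g1 ^ i * g2) * x1 =
            (q11 ^ i * q21) • (x1 ^ (a + 1) * (g1 ^ i * g2)) := by
          rw [mul_assoc, mul_assoc, h21, mul_smul_comm, ← mul_assoc (g1 ^ i), hxg,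
            smul_mul_assoc, mul_smul_comm, mul_smul_comm, smul_smul, pow_succ, mul_comm q21]
          simp only [mul_assoc]
        have f4 : x1 ^ a * (g1 ^ i * g2) * g1 = x1 ^ a * (g1 ^ (i + 1) * g2) := by
          rw [mul_assoc, mul_assoc, ← hcomm, pow_succ]
          simp only [mul_assoc]
        simp only [T, add_mul, mul_add, Algebra.TensorProduct.tmul_mul_tmul, one_mul, mul_one,
          f1, f2, f3, f4, hu, TensorProduct.tmul_sub, TensorProduct.tmul_smul,
          ← TensorProduct.smul_tmul']
        module
      have h0 : (x1 ⊗ₜ[k] (1 : A) + g1 ⊗ₜ[k] x1) * (u n ⊗ₜ[k] (1 : A)) -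
            (q11 ^ n * q12) • ((u n ⊗ₜ[k] (1 : A)) * (x1 ⊗ₜ[k] (1 : A) + g1 ⊗ₜ[k] x1)) =
          u (n + 1) ⊗ₜ[k] (1 : A) := by
        simp only [add_mul, mul_add, Algebra.TensorProduct.tmul_mul_tmul, one_mul, mul_one,
          hgu, hu, TensorProduct.sub_tmul, ← TensorProduct.smul_tmul']
        module
      rw [serreC_sum, ← h0]
      conv_lhs => rw [hu]
      rw [map_sub, map_smul, Bialgebra.comul_mul, Bialgebra.comul_mul, ih, hx1]
      rw [← Finset.sum_congr rfl fun x hx => congrArg _ (hT x hx)]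
      rw [mul_add, add_mul _ _ (x1 ⊗ₜ[k] (1 : A) + g1 ⊗ₜ[k] x1), Finset.mul_sum, Finset.sum_mul]
      simp only [smul_sub, Finset.sum_sub_distrib, mul_smul_comm, smul_mul_assoc, smul_add,
        Finset.smul_sum]
      have hsc : ∀ (a i : ℕ) (t : A ⊗[k] A), (q11 ^ n * q12) • serreC q11 (q12 * q21) a i • t =
          serreC q11 (q12 * q21) a i • (q11 ^ n * q12) • t := fun a i t => smul_comm _ _ _
      simp only [hsc]
      abel
  rw [main r, Finset.sum_eq_single (0, r)]
  · simp [T, serreC_zero_left]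
  · rintro ⟨a, i⟩ hx hne
    rw [Finset.HasAntidiagonal.mem_antidiagonal] at hx
    rcases a with _ | a
    · exact absurd (by simpa using hx) (by simpa using hne)
    · have : serreC q11 (q12 * q21) (a + 1) i = 0 := by
        unfold serreC
        rw [Finset.prod_range_succ]
        have e : i + a = r - 1 := by dsimp only at hx; omega
        rw [e, ← mul_assoc (q11 ^ (r - 1)), hq]
        simp
      simp [this]
  · intro h
    simp at h
end

section
/- (Lemma 4.2(1)) Set q := q11*q12*q21*q22 and suppose q has finite multiplicative order N. Assume q22 = −1 and x2^2 = 0 in A. Define w := x1*x2 − q12 • (x2*x1), and define z_0 := x1, z_k := z_{k−1} * w − (q11 * q12 * q^{k−1}) • (w * z_{k−1}) for k ≥ 1. Then Δ(w^N) = w^N ⊗ 1 + (g1*g2)^N ⊗ w^N + ((q21*q22)^{N−1} * (1 − q12*q21)) • ((z_{N−1} * g2) ⊗ x2). -/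
open TensorProduct

/-- Gaussian binomials. -/
def gaussBin {k : Type*} [Field k] (q : k) : ℕ → ℕ → k
  | 0, 0 => 1
  | 0, _ + 1 => 0
  | _ + 1, 0 => 1
  | n + 1, m + 1 => q ^ (m + 1) * gaussBin q n (m + 1) + gaussBin q n m

theorem gaussBin_zero {k : Type*} [Field k] (q : k) (n : ℕ) : gaussBin q n 0 = 1 := by
  cases n <;> simp [gaussBin]

theorem gaussBin_gt {k : Type*} [Field k] (q : k) (n : ℕ) :
    ∀ m, n < m → gaussBin q n m = 0 := by
  induction n with
  | zero => intro m hm; cases m with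
    | zero => omega
    | succ m => simp [gaussBin]
  | succ n ih => intro m hm; cases m with
    | zero => omega
    | succ m => simp [gaussBin, ih m (by omega), ih (m + 1) (by omega)]

theorem gaussBin_self {k : Type*} [Field k] (q : k) (n : ℕ) : gaussBin q n n = 1 := by
  induction n with
  | zero => simp [gaussBin]
  | succ n ih => simp [gaussBin, ih, gaussBin_gt q n (n + 1) (by omega)]

theorem gaussBin_absorb {k : Type*} [Field k] (q : k) (n : ℕ) :
    ∀ m, (1 - q ^ (m + 1)) * gaussBin q (n + 1) (m + 1) = (1 - q ^ (n + 1)) * gaussBin q n m := by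
  induction n with
  | zero => intro m; cases m <;> simp [gaussBin]
  | succ n ih =>
    intro m
    have e1 : gaussBin q (n + 1 + 1) (m + 1)
      = q ^ (m + 1) * gaussBin q (n + 1) (m + 1) + gaussBin q (n + 1) m := rfl
    have i1 := ih m
    rw [e1]
    cases m with
    | zero =>
      simp only [gaussBin_zero] at *
      linear_combination q * i1
    | succ m =>
      have i2 := ih m
      have e2 : gaussBin q (n + 1) (m + 1)
        = q ^ (m + 1) * gaussBin q n (m + 1) + gaussBin q n m := rfl
      linear_combination q ^ (m + 2) * i1 + q * i2 - q * (1 - q ^ (n + 1)) * e2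

theorem gaussBin_vanish {k : Type*} [Field k] (q : k) (N : ℕ) (hord : q ^ N = 1)
    (hmin : ∀ m : ℕ, 1 ≤ m → m < N → q ^ m ≠ 1) (m : ℕ) (h1 : 1 ≤ m) (h2 : m < N) :
    gaussBin q N m = 0 := by
  obtain ⟨m, rfl⟩ : ∃ m', m = m' + 1 := ⟨m - 1, by omega⟩
  obtain ⟨n, rfl⟩ : ∃ n', N = n' + 1 := ⟨N - 1, by omega⟩
  have h := gaussBin_absorb q n m
  rw [hord, sub_self, zero_mul] at h
  rcases mul_eq_zero.1 h with h | h
  · exact absurd (sub_eq_zero.1 h).symm (hmin _ h1 h2)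
  · exact h

theorem qexpand {k B : Type*} [Field k] [Ring B] [Algebra k B] (q : k) (a y : B) (D : ℕ → B)
    (h0 : D 0 = 1) (hD : ∀ m, D m * y = q ^ m • (a * D m) + D (m + 1)) (n : ℕ) :
    y ^ n = ∑ m ∈ Finset.range (n + 1), gaussBin q n m • (a ^ (n - m) * D m) := by
  induction n with
  | zero => simp [gaussBin, h0]
  | succ n ih =>
    have e : ∀ m, (gaussBin q n m • (a ^ (n - m) * D m)) * y
        = (q ^ m * gaussBin q n m) • (a ^ (n - m + 1) * D m)
          + gaussBin q n m • (a ^ (n - m) * D (m + 1)) := by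
      intro m
      rw [smul_mul_assoc, mul_assoc, hD, mul_add, smul_add, mul_smul_comm, smul_smul,
        ← mul_assoc, ← pow_succ, mul_comm (q ^ m)]
    rw [pow_succ, ih, Finset.sum_mul, Finset.sum_congr rfl (fun m _ => e m),
      Finset.sum_add_distrib, Finset.sum_range_succ' _ (n + 1)]
    have e2 : ∑ m ∈ Finset.range (n + 1), (q ^ m * gaussBin q n m) • (a ^ (n - m + 1) * D m)
        = ∑ m ∈ Finset.range (n + 1), (q ^ (m + 1) * gaussBin q n (m + 1)) •
            (a ^ (n - m) * D (m + 1)) + a ^ (n + 1) * D 0 := by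
      rw [Finset.sum_range_succ' _ n, Finset.sum_range_succ _ n,
        gaussBin_gt q n (n + 1) (by omega)]
      simp only [gaussBin_zero, mul_zero, zero_smul, add_zero, pow_zero, mul_one, one_smul,
        Nat.sub_zero]
      congr 1
      refine Finset.sum_congr rfl fun m hm => ?_
      have : n - (m + 1) + 1 = n - m := by have := Finset.mem_range.1 hm; omega
      rw [this]
    rw [e2, add_right_comm, ← Finset.sum_add_distrib]
    simp only [gaussBin_zero, one_smul, Nat.sub_zero]
    congr 1
    refine Finset.sum_congr rfl fun m hm => ?_
    rw [← add_smul, Nat.add_sub_add_right]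
    rfl

theorem qfrob {k B : Type*} [Field k] [Ring B] [Algebra k B] (q : k) (a y : B) (D : ℕ → B)
    (h0 : D 0 = 1) (hD : ∀ m, D m * y = q ^ m • (a * D m) + D (m + 1)) (N : ℕ) (hN : 1 ≤ N)
    (hord : q ^ N = 1) (hmin : ∀ m : ℕ, 1 ≤ m → m < N → q ^ m ≠ 1) :
    y ^ N = a ^ N + D N := by
  rw [qexpand q a y D h0 hD N]
  obtain ⟨n, rfl⟩ : ∃ n', N = n' + 1 := ⟨N - 1, by omega⟩
  rw [Finset.sum_range_succ, Finset.sum_range_succ', Finset.sum_eq_zero]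
  · simp [gaussBin_zero, gaussBin_self, h0]
  · intro m hm
    rw [gaussBin_vanish q (n + 1) hord hmin (m + 1) (by omega)
      (by have := Finset.mem_range.1 hm; omega), zero_smul]

/-- Lemma 4.2(1): coproduct of `[x1x2]^N` in the quotient by `x2^2`, when `q22 = -1`
and `q := q_{12,12}` has order `N`. -/
theorem comul_pow_w_case1
    {k A : Type*} [Field k] [CharZero k] [Ring A] [Bialgebra k A]
    (g1 g2 x1 x2 : A) (q11 q12 q21 q22 : k)
    (hg1 : Coalgebra.comul (R := k) g1 = g1 ⊗ₜ[k] g1)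
    (hg2 : Coalgebra.comul (R := k) g2 = g2 ⊗ₜ[k] g2)
    (hεg1 : Coalgebra.counit (R := k) g1 = 1)
    (hεg2 : Coalgebra.counit (R := k) g2 = 1)
    (hcomm : g1 * g2 = g2 * g1)
    (hx1 : Coalgebra.comul (R := k) x1 = x1 ⊗ₜ[k] (1 : A) + g1 ⊗ₜ[k] x1)
    (hx2 : Coalgebra.comul (R := k) x2 = x2 ⊗ₜ[k] (1 : A) + g2 ⊗ₜ[k] x2)
    (hq11 : q11 ≠ 0) (hq12 : q12 ≠ 0) (hq21 : q21 ≠ 0) (hq22 : q22 ≠ 0)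
    (h11 : g1 * x1 = q11 • (x1 * g1)) (h12 : g1 * x2 = q12 • (x2 * g1))
    (h21 : g2 * x1 = q21 • (x1 * g2)) (h22 : g2 * x2 = q22 • (x2 * g2))
    (hq22 : q22 = -1) (hx2sq : x2 ^ 2 = 0)
    (q : k) (hq : q = q11 * q12 * q21 * q22)
    (N : ℕ) (hN : 1 ≤ N)
    (hord : q ^ N = 1) (hmin : ∀ m : ℕ, 1 ≤ m → m < N → q ^ m ≠ 1)
    (w : A) (hw : w = x1 * x2 - q12 • (x2 * x1))
    (z : ℕ → A) (hz0 : z 0 = x1)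
    (hz : ∀ n : ℕ, z (n + 1) = z n * w - (q11 * q12 * q ^ n) • (w * z n)) :
    Coalgebra.comul (R := k) (w ^ N)
      = (w ^ N) ⊗ₜ[k] (1 : A) + ((g1 * g2) ^ N) ⊗ₜ[k] (w ^ N)
        + ((q21 * q22) ^ (N - 1) * (1 - q12 * q21)) • ((z (N - 1) * g2) ⊗ₜ[k] x2) := by
  have hw1 : g1 * w = (q11 * q12) • (w * g1) := by
    have e1 : g1 * (x1 * x2) = (q11 * q12) • (x1 * x2 * g1) := by
      rw [← mul_assoc, h11, smul_mul_assoc, mul_assoc, h12, mul_smul_comm, smul_smul, mul_assoc]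
    have e2 : g1 * (x2 * x1) = (q11 * q12) • (x2 * x1 * g1) := by
      rw [← mul_assoc, h12, smul_mul_assoc, mul_assoc, h11, mul_smul_comm, smul_smul, mul_assoc,
        mul_comm q12]
    rw [hw, mul_sub, mul_smul_comm, e1, e2, sub_mul, smul_sub, smul_mul_assoc, smul_comm q12]
  have hw2 : g2 * w = (q21 * q22) • (w * g2) := by
    have e1 : g2 * (x1 * x2) = (q21 * q22) • (x1 * x2 * g2) := by
      rw [← mul_assoc, h21, smul_mul_assoc, mul_assoc, h22, mul_smul_comm, smul_smul, mul_assoc]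
    have e2 : g2 * (x2 * x1) = (q21 * q22) • (x2 * x1 * g2) := by
      rw [← mul_assoc, h22, smul_mul_assoc, mul_assoc, h21, mul_smul_comm, smul_smul, mul_assoc,
        mul_comm q22]
    rw [hw, mul_sub, mul_smul_comm, e1, e2, sub_mul, smul_sub, smul_mul_assoc, smul_comm q12]
  have hgw : g1 * g2 * w = q • (w * (g1 * g2)) := by
    rw [mul_assoc, hw2, mul_smul_comm, ← mul_assoc, hw1, smul_mul_assoc, smul_smul, mul_assoc w, hq]
    congr 1; ring
  have hxx : x2 * x2 = 0 := by rw [← sq, hx2sq]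
  have hwx : w * x2 = (q12 * q22) • (x2 * w) := by
    rw [hw, sub_mul, mul_sub, smul_mul_assoc, mul_smul_comm, mul_assoc x1, hxx, ← mul_assoc x2 x2,
      hxx, hq22, mul_assoc]
    simp
  have hgx : g1 * g2 * (x1 * g2) = (q11 * q21) • (x1 * g2 * (g1 * g2)) := by
    have e : g2 * (g1 * g2) = g1 * (g2 * g2) := by rw [← mul_assoc, ← hcomm, mul_assoc]
    rw [mul_assoc, ← mul_assoc g2, h21, smul_mul_assoc, mul_smul_comm, ← mul_assoc, ← mul_assoc,
      h11, smul_mul_assoc, smul_mul_assoc, smul_smul, mul_comm q21, mul_assoc x1 g2, e]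
    simp only [mul_assoc]
  have hΔ : Coalgebra.comul (R := k) w = w ⊗ₜ[k] (1 : A) + (g1 * g2) ⊗ₜ[k] w
      + (1 - q12 * q21) • ((x1 * g2) ⊗ₜ[k] x2) := by
    rw [hw, map_sub, map_smul, Bialgebra.comul_mul, Bialgebra.comul_mul, hx1, hx2]
    simp only [add_mul, mul_add, Algebra.TensorProduct.tmul_mul_tmul, one_mul, mul_one, h12, h21,
      ← hcomm, sub_tmul, tmul_sub, ← smul_tmul', tmul_smul]
    module
  clear hw
  set β := 1 - q12 * q21
  set p := q21 * q22
  let D : ℕ → A ⊗[k] A := fun n => Nat.casesOn n 1 (fun m => (β * p ^ m) • ((z m * g2) ⊗ₜ[k] x2))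
  have hD0 : D 0 = 1 := rfl
  have hDs : ∀ m, D (m + 1) = (β * p ^ m) • ((z m * g2) ⊗ₜ[k] x2) := fun m => rfl
  have hD1 : D 1 = (β * p ^ 0) • ((z 0 * g2) ⊗ₜ[k] x2) := rfl
  have hy := qfrob q (w ⊗ₜ[k] (1 : A)) (w ⊗ₜ[k] (1 : A) + D 1) D hD0 (by
    intro m
    cases m with
    | zero => simp [hD0]
    | succ m =>
      have e : z m * g2 * w = p • (z m * w * g2) := by
        rw [mul_assoc, hw2, mul_smul_comm, mul_assoc]
      have e2 : z m * w * g2 = z (m + 1) * g2 + (q11 * q12 * q ^ m) • (w * (z m * g2)) := by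
        rw [hz, sub_mul, smul_mul_assoc, mul_assoc w]; abel
      rw [hDs, hD1, hDs (m + 1)]
      simp only [mul_add, smul_mul_assoc, mul_smul_comm, Algebra.TensorProduct.tmul_mul_tmul,
        one_mul, mul_one, hxx, tmul_zero, smul_zero, add_zero, e, e2, ← smul_tmul', add_tmul,
        smul_add, smul_smul]
      rw [add_comm]
      congr 2
      · rw [pow_succ q, hq]; ring
      · ring) N hN hord hmin
  have hby : ((g1 * g2) ⊗ₜ[k] w) * (w ⊗ₜ[k] (1 : A) + D 1)
      = q • ((w ⊗ₜ[k] (1 : A) + D 1) * ((g1 * g2) ⊗ₜ[k] w)) := by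
    rw [hD1, hz0]
    simp only [mul_add, add_mul, smul_mul_assoc, mul_smul_comm,
      Algebra.TensorProduct.tmul_mul_tmul, one_mul, mul_one, hgw, hgx, hwx, ← smul_tmul',
      tmul_smul, smul_add, smul_smul]
    congr 2
    rw [hq]; ring
  generalize hY : w ⊗ₜ[k] (1 : A) + D 1 = y at hy hby
  generalize hb : (g1 * g2) ⊗ₜ[k] w = b at hby
  have hbm : ∀ m, b ^ m * y = q ^ m • (y * b ^ m) := by
    intro m
    induction m with
    | zero => simp
    | succ m ih =>
      rw [pow_succ, mul_assoc, hby, mul_smul_comm, ← mul_assoc, ih, smul_mul_assoc, smul_smul,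
        mul_assoc, pow_succ, mul_comm q]
  have hf := qfrob q y (y + b) (fun m => b ^ m) (pow_zero b) (by
    intro m
    rw [mul_add, hbm, pow_succ]) N hN hord hmin
  have hW : Coalgebra.comul (R := k) w = y + b := by
    rw [hΔ, ← hY, ← hb, hD1, hz0]
    simp only [pow_zero, mul_one]
    abel
  rw [Bialgebra.comul_pow, hW, hf, hy, ← hb, Algebra.TensorProduct.tmul_pow,
    Algebra.TensorProduct.tmul_pow, one_pow]
  obtain ⟨n, rfl⟩ : ∃ n', N = n' + 1 := ⟨N - 1, by omega⟩
  rw [hDs, Nat.add_sub_cancel, mul_comm β]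
  abel
end

section
/- (Lemma 4.3(1)) Define w := x1*x2 − q12 • (x2*x1), w112 := x1*w − (q11*q12) • (w*x1), and w5 := w112*w − (q11^2*q12^2*q21*q22) • (w*w112). Assume q22 = −1, the scalar q11*q12*q21*q22 has multiplicative order 3, and x2^2 = 0 in A. Then w5 is (1, g1^3*g2^2)-skew-primitive: Δ(w5) = w5 ⊗ 1 + (g1^3*g2^2) ⊗ w5. -/
set_option linter.unusedSimpArgs false

open TensorProduct

/-- Lemma 4.3(1): if `q22 = -1`, `ord(q11*q12*q21*q22) = 3` and `x2^2 = 0`, then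
`[x1x1x2x1x2]` is `(1, g1^3*g2^2)`-skew-primitive. -/
theorem w11212_skew_primitive_case1
    {k A : Type*} [Field k] [CharZero k] [Ring A] [Bialgebra k A]
    (g1 g2 x1 x2 : A) (q11 q12 q21 q22 : k)
    (hg1 : Coalgebra.comul (R := k) g1 = g1 ⊗ₜ[k] g1)
    (hg2 : Coalgebra.comul (R := k) g2 = g2 ⊗ₜ[k] g2)
    (hεg1 : Coalgebra.counit (R := k) g1 = 1)
    (hεg2 : Coalgebra.counit (R := k) g2 = 1)
    (hcomm : g1 * g2 = g2 * g1)
    (hx1 : Coalgebra.comul (R := k) x1 = x1 ⊗ₜ[k] (1 : A) + g1 ⊗ₜ[k] x1)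
    (hx2 : Coalgebra.comul (R := k) x2 = x2 ⊗ₜ[k] (1 : A) + g2 ⊗ₜ[k] x2)
    (hq11 : q11 ≠ 0) (hq12 : q12 ≠ 0) (hq21 : q21 ≠ 0) (hq22 : q22 ≠ 0)
    (h11 : g1 * x1 = q11 • (x1 * g1)) (h12 : g1 * x2 = q12 • (x2 * g1))
    (h21 : g2 * x1 = q21 • (x1 * g2)) (h22 : g2 * x2 = q22 • (x2 * g2))
    (w w112 w5 : A)
    (hw : w = x1 * x2 - q12 • (x2 * x1))
    (hw112 : w112 = x1 * w - (q11 * q12) • (w * x1))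
    (hw5 : w5 = w112 * w - (q11 ^ 2 * q12 ^ 2 * q21 * q22) • (w * w112))
    (hq22 : q22 = -1)
    (hord : (q11 * q12 * q21 * q22) ^ 3 = 1)
    (hmin : ∀ m : ℕ, 1 ≤ m → m < 3 → (q11 * q12 * q21 * q22) ^ m ≠ 1)
    (hx2sq : x2 ^ 2 = 0) :
    Coalgebra.comul (R := k) w5 = w5 ⊗ₜ[k] (1 : A) + (g1 ^ 3 * g2 ^ 2) ⊗ₜ[k] w5 := by
  subst hq22
  have hp : (q11 * q12 * q21) ^ 2 - q11 * q12 * q21 + 1 = 0 := by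
    have h1 := hmin 1 le_rfl (by norm_num)
    have h2 : q11 * q12 * q21 * -1 - 1 ≠ 0 := fun h => h1 (by linear_combination h)
    apply mul_left_cancel₀ h2
    linear_combination hord
  have hxx : x2 * x2 = 0 := by rw [← pow_two]; exact hx2sq
  -- commutation of the group-likes
  have c21 : g2 * g1 = g1 * g2 := hcomm.symm
  have a11 (z : A) : g1 * (x1 * z) = q11 • (x1 * (g1 * z)) := by
    rw [← mul_assoc, h11, smul_mul_assoc, mul_assoc]
  have a12 (z : A) : g1 * (x2 * z) = q12 • (x2 * (g1 * z)) := by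
    rw [← mul_assoc, h12, smul_mul_assoc, mul_assoc]
  have a21 (z : A) : g2 * (x1 * z) = q21 • (x1 * (g2 * z)) := by
    rw [← mul_assoc, h21, smul_mul_assoc, mul_assoc]
  have a22 (z : A) : g2 * (x2 * z) = (-1 : k) • (x2 * (g2 * z)) := by
    rw [← mul_assoc, h22, smul_mul_assoc, mul_assoc]
  have ac (z : A) : g2 * (g1 * z) = g1 * (g2 * z) := by
    rw [← mul_assoc, c21, mul_assoc]
  have g1w : g1 * w = (q11 * q12) • (w * g1) := by
    rw [hw]
    simp only [mul_sub, sub_mul, mul_smul_comm, smul_mul_assoc, mul_assoc, a11, a12, h11, h12]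
    module
  have g2w : g2 * w = (-q21) • (w * g2) := by
    rw [hw]
    simp only [mul_sub, sub_mul, mul_smul_comm, smul_mul_assoc, mul_assoc, a21, a22, h21, h22]
    module
  have b1 (z : A) : g1 * (w * z) = (q11 * q12) • (w * (g1 * z)) := by
    rw [← mul_assoc, g1w, smul_mul_assoc, mul_assoc]
  have b2 (z : A) : g2 * (w * z) = (-q21) • (w * (g2 * z)) := by
    rw [← mul_assoc, g2w, smul_mul_assoc, mul_assoc]
  -- relations in the right tensor slot
  have e12 : x1 * x2 = w + q12 • (x2 * x1) := by rw [hw]; abel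
  have e1w : x1 * w = w112 + (q11 * q12) • (w * x1) := by rw [hw112]; abel
  have ewx : w * x2 = (-q12) • (x2 * w) := by
    rw [hw]
    simp only [mul_sub, sub_mul, mul_smul_comm, smul_mul_assoc, mul_assoc, hxx]
    rw [← mul_assoc x2 x2, hxx]
    simp
  have e112 : w112 * x2 = (-(q12 * (1 + q11))) • (w * w) - (q12 ^ 2) • (x2 * w112) := by
    have t1 : x1 * (w * x2) = (-q12) • (w * w) - (q12 ^ 2) • (x2 * (x1 * w)) := by
      rw [ewx, mul_smul_comm, ← mul_assoc, e12]
      simp only [add_mul, smul_mul_assoc, mul_assoc]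
      module
    have t2 : w * (x1 * x2) = w * w - (q12 ^ 2) • (x2 * (w * x1)) := by
      rw [e12, mul_add, mul_smul_comm, ← mul_assoc w x2, ewx]
      simp only [smul_mul_assoc, mul_assoc]
      module
    rw [hw112]
    simp only [sub_mul, mul_sub, smul_mul_assoc, mul_smul_comm, mul_assoc, t1, t2]
    module
  -- comultiplications
  have dw : Coalgebra.comul (R := k) w = w ⊗ₜ[k] (1 : A)
      + (1 - q12 * q21) • ((x1 * g2) ⊗ₜ[k] x2) + (g1 * g2) ⊗ₜ[k] w := by
    conv_lhs => rw [hw]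
    rw [map_sub, map_smul, Bialgebra.comul_mul, Bialgebra.comul_mul, hx1, hx2]
    simp only [mul_add, add_mul, Algebra.TensorProduct.tmul_mul_tmul, mul_one, one_mul, h12, h21,
      c21, e12]
    rw [hw]
    simp only [TensorProduct.sub_tmul, TensorProduct.tmul_sub, TensorProduct.add_tmul,
      TensorProduct.tmul_add, ← TensorProduct.smul_tmul', TensorProduct.tmul_smul]
    module
  have dw112 : Coalgebra.comul (R := k) w112 = w112 ⊗ₜ[k] (1 : A)
      + ((1 - q12 * q21) * (1 - q11 * q12 * q21)) • ((x1 * (x1 * g2)) ⊗ₜ[k] x2)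
      + ((1 + q11) * (1 - q11 * q12 * q21)) • ((x1 * (g1 * g2)) ⊗ₜ[k] w)
      + (g1 * (g1 * g2)) ⊗ₜ[k] w112 := by
    conv_lhs => rw [hw112]
    rw [map_sub, map_smul, Bialgebra.comul_mul, Bialgebra.comul_mul, hx1, dw]
    simp only [mul_add, add_mul, Algebra.TensorProduct.tmul_mul_tmul, mul_one, one_mul,
      smul_mul_assoc, mul_smul_comm, mul_assoc, h11, h12, h21, a11, a21, b1, g1w, c21, ac, e12, e1w]
    rw [hw112]
    simp only [TensorProduct.sub_tmul, TensorProduct.tmul_sub, TensorProduct.add_tmul,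
      TensorProduct.tmul_add, ← TensorProduct.smul_tmul', TensorProduct.tmul_smul]
    module
  have hG : g1 ^ 3 * g2 ^ 2 = g1 * (g1 * (g1 * (g2 * g2))) := by
    simp only [pow_succ, pow_zero, one_mul, mul_assoc]
  have dw5 : Coalgebra.comul (R := k) w5 = Coalgebra.comul (R := k) w112 * Coalgebra.comul (R := k) w
      - (q11 ^ 2 * q12 ^ 2 * q21 * -1) • (Coalgebra.comul (R := k) w * Coalgebra.comul (R := k) w112) := by
    rw [hw5, map_sub, map_smul, Bialgebra.comul_mul, Bialgebra.comul_mul]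
  rw [dw5, dw112, dw, hw5, hG]
  have hL : w112 ⊗ₜ[k] (1 : A) = (x1 * w) ⊗ₜ[k] (1 : A) - (q11 * q12) • ((w * x1) ⊗ₜ[k] (1 : A)) := by
    rw [hw112, TensorProduct.sub_tmul, TensorProduct.smul_tmul']
  rw [hL]
  have hL2 : (w112 * w - (q11 ^ 2 * q12 ^ 2 * q21 * -1) • (w * w112)) ⊗ₜ[k] (1 : A)
     = ((x1 * (w * w)) - (q11 * q12) • (w * (x1 * w)) - (q11 ^ 2 * q12 ^ 2 * q21 * -1) • (w * (x1 * w)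
        - (q11 * q12) • (w * (w * x1)))) ⊗ₜ[k] (1 : A) := by
    rw [hw112]
    simp only [sub_mul, mul_sub, smul_mul_assoc, mul_smul_comm, mul_assoc]
  rw [hL2]
  clear hL hL2
  simp only [mul_add, add_mul, mul_sub, sub_mul, Algebra.TensorProduct.tmul_mul_tmul, mul_one, one_mul,
      smul_mul_assoc, mul_smul_comm, mul_assoc, h11, h12, h21, a11, a21, b1, b2, g1w, g2w, c21, ac,
      ewx, e112, hxx]
  simp only [TensorProduct.sub_tmul, TensorProduct.tmul_sub, TensorProduct.add_tmul,
      TensorProduct.tmul_add, ← TensorProduct.smul_tmul', TensorProduct.tmul_smul, TensorProduct.tmul_zero,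
      smul_zero, smul_add, smul_sub, add_zero, zero_add, smul_smul]
  rw [← sub_eq_zero]
  match_scalars
  all_goals first | ring1 | grind
end

section
/- (Lemma 4.3(2), first quotient) Define w := x1*x2 − q12 • (x2*x1), w112 := x1*w − (q11*q12) • (w*x1), w1112 := x1*w112 − (q11^2*q12) • (w112*x1), and w5 := w112*w − (q11^2*q12^2*q21*q22) • (w*w112). Assume q22 = −1, q12*q21 = q11^{−2}, q11 has multiplicative order 3, and in A one has x2^2 = 0 and w1112 = 0. Then w5 is (1, g1^3*g2^2)-skew-primitive: Δ(w5) = w5 ⊗ 1 + (g1^3*g2^2) ⊗ w5. -/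
open TensorProduct

/-- Right-multiplied form of a rewriting rule. -/
theorem w11212_assoc {A : Type*} [Ring A] {a b c : A} (h : a * b = c) (z : A) :
    a * (b * z) = c * z := by rw [← mul_assoc, h]

/-- Lemma 4.3(2), first quotient: if `q22 = -1`, `q12*q21 = q11^{-2}`, `ord q11 = 3`,
`x2^2 = 0` and `[x1x1x1x2] = 0`, then `[x1x1x2x1x2]` is `(1, g1^3*g2^2)`-skew-primitive. -/
theorem w11212_skew_primitive_case2a
    {k A : Type*} [Field k] [CharZero k] [Ring A] [Bialgebra k A]
    (g1 g2 x1 x2 : A) (q11 q12 q21 q22 : k)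
    (hg1 : Coalgebra.comul (R := k) g1 = g1 ⊗ₜ[k] g1)
    (hg2 : Coalgebra.comul (R := k) g2 = g2 ⊗ₜ[k] g2)
    (hεg1 : Coalgebra.counit (R := k) g1 = 1)
    (hεg2 : Coalgebra.counit (R := k) g2 = 1)
    (hcomm : g1 * g2 = g2 * g1)
    (hx1 : Coalgebra.comul (R := k) x1 = x1 ⊗ₜ[k] (1 : A) + g1 ⊗ₜ[k] x1)
    (hx2 : Coalgebra.comul (R := k) x2 = x2 ⊗ₜ[k] (1 : A) + g2 ⊗ₜ[k] x2)
    (hq11 : q11 ≠ 0) (hq12 : q12 ≠ 0) (hq21 : q21 ≠ 0) (hq22 : q22 ≠ 0)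
    (h11 : g1 * x1 = q11 • (x1 * g1)) (h12 : g1 * x2 = q12 • (x2 * g1))
    (h21 : g2 * x1 = q21 • (x1 * g2)) (h22 : g2 * x2 = q22 • (x2 * g2))
    (w w112 w1112 w5 : A)
    (hw : w = x1 * x2 - q12 • (x2 * x1))
    (hw112 : w112 = x1 * w - (q11 * q12) • (w * x1))
    (hw1112 : w1112 = x1 * w112 - (q11 ^ 2 * q12) • (w112 * x1))
    (hw5 : w5 = w112 * w - (q11 ^ 2 * q12 ^ 2 * q21 * q22) • (w * w112))
    (hq22 : q22 = -1)
    (hcartan : q12 * q21 = (q11 ^ 2)⁻¹)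
    (hord : q11 ^ 3 = 1)
    (hmin : ∀ m : ℕ, 1 ≤ m → m < 3 → q11 ^ m ≠ 1)
    (hx2sq : x2 ^ 2 = 0) (hw1112zero : w1112 = 0) :
    Coalgebra.comul (R := k) w5 = w5 ⊗ₜ[k] (1 : A) + (g1 ^ 3 * g2 ^ 2) ⊗ₜ[k] w5 := by
  have hc : q12 * q21 = q11 := by
    rw [hcartan]; field_simp; exact hord.symm
  have hq : q11 ^ 2 + q11 + 1 = 0 := by
    have h1 : q11 - 1 ≠ 0 := fun h => hmin 1 le_rfl (by norm_num) (by linear_combination h)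
    apply mul_left_cancel₀ h1
    linear_combination hord
  subst hq22
  clear hcartan hmin hεg1 hεg2
  rw [hw1112zero] at hw1112
  -- rewriting rules
  have e12 : x1 * x2 = w + q12 • (x2 * x1) := by rw [hw]; module
  have e1w : x1 * w = w112 + (q11 * q12) • (w * x1) := by rw [hw112]; module
  have e1112 : x1 * w112 = (q11 ^ 2 * q12) • (w112 * x1) := (sub_eq_zero.mp hw1112.symm)
  have e22 : x2 * x2 = 0 := by rw [← pow_two, hx2sq]
  have ew2 : w * x2 = (-q12) • (x2 * w) := by
    rw [hw]
    simp only [sub_mul, mul_sub, smul_mul_assoc, mul_smul_comm, mul_assoc, e22,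
      w11212_assoc e22, mul_zero, zero_mul, smul_zero]
    module
  have ew1122 : w112 * x2 = (-(q12 * (1 + q11))) • (w * w) - (q12 ^ 2) • (x2 * w112) := by
    have : w112 * x2 = x1 * (w * x2) - (q11 * q12) • (w * (x1 * x2)) := by
      rw [hw112]; simp only [sub_mul, smul_mul_assoc, mul_assoc]
    rw [this, ew2, e12]
    simp only [mul_add, add_mul, smul_mul_assoc, mul_smul_comm, w11212_assoc e12,
      w11212_assoc ew2, mul_assoc, e1w]
    module
  have e112w : w112 * w = w5 + (-q12) • (w * w112) := by
    rw [hw5]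
    have : q11 ^ 2 * q12 ^ 2 * q21 * -1 = -q12 := by
      linear_combination (- q11 ^ 2 * q12) * hc - q12 * hord
    rw [this]; module
  have g12 : g2 * g1 = g1 * g2 := hcomm.symm
  have g1w : g1 * w = (q11 * q12) • (w * g1) := by
    rw [hw]
    simp only [sub_mul, mul_sub, smul_mul_assoc, mul_smul_comm, mul_assoc, h11, h12,
      w11212_assoc h11, w11212_assoc h12]
    module
  have g2w : g2 * w = (-q21) • (w * g2) := by
    rw [hw]
    simp only [sub_mul, mul_sub, smul_mul_assoc, mul_smul_comm, mul_assoc, h21, h22,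
      w11212_assoc h21, w11212_assoc h22]
    module
  have g1w112 : g1 * w112 = (q11 ^ 2 * q12) • (w112 * g1) := by
    rw [hw112]
    simp only [sub_mul, mul_sub, smul_mul_assoc, mul_smul_comm, mul_assoc, h11, g1w,
      w11212_assoc h11, w11212_assoc g1w]
    module
  have g2w112 : g2 * w112 = (-q21 ^ 2) • (w112 * g2) := by
    rw [hw112]
    simp only [sub_mul, mul_sub, smul_mul_assoc, mul_smul_comm, mul_assoc, h21, g2w,
      w11212_assoc h21, w11212_assoc g2w]
    module
  have dw : Coalgebra.comul (R := k) w = w ⊗ₜ[k] (1 : A) + (1 - q11) • ((x1 * g2) ⊗ₜ[k] x2)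
      + (g1 * g2) ⊗ₜ[k] w := by
    conv_lhs => rw [hw]
    simp only [map_sub, map_smul, Bialgebra.comul_mul]
    simp only [hx1, hx2, mul_add, add_mul,
      Algebra.TensorProduct.tmul_mul_tmul, mul_one, one_mul, h11, h12, h21, h22, g12, e12,
      add_tmul, tmul_add, tmul_smul, ← smul_tmul', smul_add, smul_smul]
    match_scalars <;> clear * - hc hq <;> grind
  have dw112 : Coalgebra.comul (R := k) w112 = w112 ⊗ₜ[k] (1 : A)
      + ((1 - q11) * (1 - q11 ^ 2)) • ((x1 * (x1 * g2)) ⊗ₜ[k] x2)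
      + ((1 + q11) * (1 - q11 ^ 2)) • ((x1 * (g1 * g2)) ⊗ₜ[k] w)
      + (g1 * (g1 * g2)) ⊗ₜ[k] w112 := by
    conv_lhs => rw [hw112]
    simp only [map_sub, map_smul, Bialgebra.comul_mul]
    simp only [hx1, dw, mul_add, add_mul,
      smul_mul_assoc, mul_smul_comm, mul_assoc,
      Algebra.TensorProduct.tmul_mul_tmul, mul_one, one_mul, h11, h12, h21, h22, g12, e12,
      g1w, g2w, e1w, w11212_assoc h11, w11212_assoc h21, w11212_assoc g12,
      add_tmul, tmul_add, tmul_smul, ← smul_tmul', smul_add, smul_smul]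
    match_scalars <;> clear * - hc hq <;> grind
  conv_lhs => rw [hw5]
  simp only [map_sub, map_smul, Bialgebra.comul_mul]
  simp only [dw112, dw, mul_add, add_mul,
    smul_mul_assoc, mul_smul_comm, mul_assoc, pow_succ, pow_zero,
    Algebra.TensorProduct.tmul_mul_tmul, mul_one, one_mul, mul_zero, zero_mul,
    h11, h12, h21, h22, g12, e12, e22, w11212_assoc e12, w11212_assoc e1w,
    w11212_assoc e1112, e1112, ew2, ew1122, e112w,
    g1w, g2w, e1w, g1w112, g2w112, w11212_assoc h11, w11212_assoc h21, w11212_assoc g12,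
    w11212_assoc g1w, w11212_assoc g2w, w11212_assoc g1w112, w11212_assoc g2w112,
    add_tmul, tmul_add, sub_tmul, tmul_sub, tmul_smul, ← smul_tmul', smul_add, smul_sub,
    smul_smul, tmul_zero, smul_zero]
  match_scalars <;> clear * - hc hq <;> grind
end

section
/- (Lemma 4.4(4)) Let r ∈ ℤ. If q_ij * q_ji = q_ii^{−(r−1)} and q_jj ≠ 1, then χ_i^r * χ_j ≠ χ_i (as characters Γ → kˣ, where χ_i^r denotes the r-th power in the character group). -/
/-- Lemma 4.4(4): if `q_ij * q_ji = q_ii^{-(r-1)}` and `q_jj ≠ 1`,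
then `χ_i^r * χ_j ≠ χ_i`. -/
theorem character_combinatorics_4 {k Γ : Type*} [Field k] [CommGroup Γ]
    (gi gj : Γ) (χi χj : Γ →* kˣ) (r : ℤ)
    (hq : χj gi * χi gj = (χi gi) ^ (-(r - 1)))
    (hjj : χj gj ≠ 1) :
    χi ^ r * χj ≠ χi := by
  intro h
  have key : ∀ g, χj g = (χi g) ^ (-(r - 1)) := by
    intro g
    have hg : (χi g) ^ r * χj g = χi g := DFunLike.congr_fun h g
    rw [neg_sub, sub_eq_add_neg, zpow_add, zpow_one, zpow_neg, eq_mul_inv_iff_mul_eq, mul_comm]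
    exact hg
  rw [← key gi] at hq
  have h1 : χi gj = 1 := mul_eq_left.mp hq
  apply hjj
  rw [key gj, h1, one_zpow]
end
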